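/- arXiv:1209.5786 — 6 statements merged into one kernel-verified Lean document; each statement's English description precedes it below -/
import Mathlib

section
/- Let T ∈ (0, ∞], K ∈ ℝ and ν ≥ 0. Let g : [0,T) → ℝ be continuous and let a : [0,T) → ℝ be continuously differentiable on [0,T) and twice continuously differentiable on (0,T), satisfying a''(s) ≥ 2K·a'(s) + ν·g(s) for every s ∈ (0,T). Then for every τ ∈ [0,T): I_{2K}(τ)·a'(0) + ν·∫₀^τ I_{2K}(τ−s)·g(s) ds ≤ a(τ) − a(0). -/
open MeasureTheory Filter Topology

/-- `I_K(t) = ∫₀ᵗ e^{Ks} ds`. -/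
noncomputable def intI (K t : ℝ) : ℝ := ∫ s in (0:ℝ)..t, Real.exp (K * s)

theorem hasDerivAt_intI (c t : ℝ) : HasDerivAt (intI c) (Real.exp (c * t)) t := by
  have hc : Continuous fun s : ℝ => Real.exp (c * s) := by fun_prop
  exact intervalIntegral.integral_hasDerivAt_right (hc.intervalIntegrable _ _)
    hc.stronglyMeasurable.stronglyMeasurableAtFilter hc.continuousAt

theorem mul_intI (c t : ℝ) : c * intI c t = Real.exp (c * t) - 1 := by
  have h : ∀ x ∈ Set.uIcc 0 t,
      HasDerivAt (fun s => Real.exp (c * s)) (c * Real.exp (c * x)) x := fun x _ => by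
    simpa [mul_comm] using ((hasDerivAt_id x).const_mul c).exp
  have hc : Continuous fun s : ℝ => c * Real.exp (c * s) := by fun_prop
  rw [intI, ← intervalIntegral.integral_const_mul,
    intervalIntegral.integral_eq_sub_of_hasDerivAt h (hc.intervalIntegrable _ _)]
  simp

theorem intI_nonneg (c : ℝ) {t : ℝ} (ht : 0 ≤ t) : 0 ≤ intI c t :=
  intervalIntegral.integral_nonneg ht fun _ _ => (Real.exp_pos _).le

/-- Under the hypotheses `a'' ≥ 2K a' + ν g` on `(0,T)` (with `a ∈ C¹([0,T))`,
`a ∈ C²((0,T))`, `g` continuous on `[0,T)`), for every `τ ∈ [0,T)`: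
`I_{2K}(τ) a'(0) + ν ∫₀^τ I_{2K}(τ-s) g(s) ds ≤ a(τ) - a(0)`. -/
theorem stmt1 (T : EReal) (hT : 0 < T) (K ν : ℝ) (hν : 0 ≤ ν)
    (a a' a'' g : ℝ → ℝ)
    (hg : ContinuousOn g {s : ℝ | 0 ≤ s ∧ (s : EReal) < T})
    (ha : ∀ s ∈ {s : ℝ | 0 ≤ s ∧ (s : EReal) < T},
      HasDerivWithinAt a (a' s) {s : ℝ | 0 ≤ s ∧ (s : EReal) < T} s)
    (ha'cont : ContinuousOn a' {s : ℝ | 0 ≤ s ∧ (s : EReal) < T})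
    (ha' : ∀ s ∈ {s : ℝ | 0 < s ∧ (s : EReal) < T}, HasDerivAt a' (a'' s) s)
    (ha''cont : ContinuousOn a'' {s : ℝ | 0 < s ∧ (s : EReal) < T})
    (hineq : ∀ s ∈ {s : ℝ | 0 < s ∧ (s : EReal) < T},
      a'' s ≥ 2 * K * a' s + ν * g s)
    (τ : ℝ) (hτ : 0 ≤ τ) (hτT : (τ : EReal) < T) :
    intI (2 * K) τ * a' 0 + ν * ∫ s in (0:ℝ)..τ, intI (2 * K) (τ - s) * g s ≤
      a τ - a 0 := by
  have hsub : Set.Icc 0 τ ⊆ {s : ℝ | 0 ≤ s ∧ (s : EReal) < T} := fun s hs =>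
    ⟨hs.1, (EReal.coe_le_coe_iff.2 hs.2).trans_lt hτT⟩
  have hI : Continuous (intI (2 * K)) :=
    continuous_iff_continuousAt.2 fun t => (hasDerivAt_intI _ t).continuousAt
  have hIτ : Continuous fun s => intI (2 * K) (τ - s) := hI.comp (by fun_prop)
  have hw : ContinuousOn (fun s => intI (2 * K) (τ - s) * g s) (Set.Icc 0 τ) :=
    hIτ.continuousOn.mul (hg.mono hsub)
  let F : ℝ → ℝ := fun s => a s + intI (2 * K) (τ - s) * a' s
    - ν * ∫ u in (0:ℝ)..s, intI (2 * K) (τ - u) * g u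
  have hFcont : ContinuousOn F (Set.Icc 0 τ) := by
    refine ContinuousOn.sub (ContinuousOn.add ?_ ?_) (ContinuousOn.mul continuousOn_const ?_)
    · exact fun s hs => ((ha s (hsub hs)).continuousWithinAt).mono hsub
    · exact hIτ.continuousOn.mul (ha'cont.mono hsub)
    · have h := intervalIntegral.continuousOn_primitive_interval (μ := volume)
        (f := fun u => intI (2 * K) (τ - u) * g u) (a := 0) (b := τ)
        (by rw [Set.uIcc_of_le hτ]; exact hw.integrableOn_Icc)
      rwa [Set.uIcc_of_le hτ] at h
  have hFderiv : ∀ s ∈ Set.Ioo 0 τ, HasDerivAt F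
      (a' s + (-Real.exp (2 * K * (τ - s)) * a' s + intI (2 * K) (τ - s) * a'' s)
        - ν * (intI (2 * K) (τ - s) * g s)) s := by
    intro s hs
    have hnhds : Set.Icc 0 τ ∈ 𝓝 s := Icc_mem_nhds hs.1 hs.2
    have hs' := hsub (Set.Ioo_subset_Icc_self hs)
    have hda := (ha s hs').hasDerivAt (mem_of_superset hnhds hsub)
    have hdI : HasDerivAt (fun u => intI (2 * K) (τ - u)) (-Real.exp (2 * K * (τ - s))) s := by
      simpa [Function.comp_def] using
        (hasDerivAt_intI (2 * K) (τ - s)).comp s ((hasDerivAt_id s).const_sub τ)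
    have hint : IntervalIntegrable (fun u => intI (2 * K) (τ - u) * g u) volume 0 s :=
      (hw.mono (by
        rw [Set.uIcc_of_le hs.1.le]
        exact Set.Icc_subset_Icc_right hs.2.le)).intervalIntegrable
    have hmeas := (hw.mono Set.Ioo_subset_Icc_self).stronglyMeasurableAtFilter
      (μ := volume) isOpen_Ioo s hs
    have hdw := intervalIntegral.integral_hasDerivAt_right hint hmeas (hw.continuousAt hnhds)
    exact (hda.add (hdI.mul (ha' s ⟨hs.1, hs'.2⟩))).sub (hdw.const_mul ν)
  have hmono : MonotoneOn F (Set.Icc 0 τ) := by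
    refine monotoneOn_of_deriv_nonneg (convex_Icc 0 τ) hFcont ?_ ?_
    · rw [interior_Icc]
      exact fun s hs => (hFderiv s hs).differentiableAt.differentiableWithinAt
    · rw [interior_Icc]
      intro s hs
      rw [(hFderiv s hs).deriv]
      have h1 := mul_le_mul_of_nonneg_left
        (hineq s ⟨hs.1, (hsub (Set.Ioo_subset_Icc_self hs)).2⟩)
        (intI_nonneg (2 * K) (sub_nonneg.2 hs.2.le))
      linear_combination h1 - a' s * mul_intI (2 * K) (τ - s)
  have h := hmono (Set.left_mem_Icc.2 hτ) (Set.right_mem_Icc.2 hτ) hτ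
  have h0 : intI (2 * K) 0 = 0 := intervalIntegral.integral_same
  simp only [F, sub_zero, sub_self, intervalIntegral.integral_same, h0] at h
  linarith
end

section
/- Let (X,d) be a metric space, let μ_n (n ∈ ℕ) and μ be Borel probability measures on X such that μ_n converges weakly to μ (i.e. ∫ φ dμ_n → ∫ φ dμ for every bounded continuous φ : X → ℝ). Let M ≥ 0, let f_n : X → ℝ be Borel functions with |f_n| ≤ M for every n, and let f : X → ℝ be a Borel function such that limsup_{n→∞} f_n(x_n) ≤ f(x) whenever x_n → x in X. Then limsup_{n→∞} ∫_X f_n dμ_n ≤ ∫_X f dμ (note that the hypothesis forces f ≥ −M, so the right-hand integral is well defined with values in (−∞, +∞]). -/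
open MeasureTheory Filter Topology
open scoped ENNReal NNReal

/-- A bound on `limsup fₙ(xₙ)` along every sequence `xₙ → x` upgrades to a bound that is uniform
for `n` large and `y` close to `x`. -/
lemma eventually_lt_of_forall_limsup_le {X : Type*} [PseudoMetricSpace X] {M : ℝ}
    {fn : ℕ → X → ℝ} (hbd : ∀ n x, |fn n x| ≤ M) {x : X} {a b : ℝ} (hab : a < b)
    (h : ∀ xs : ℕ → X, Tendsto xs atTop (𝓝 x) → limsup (fun n => fn n (xs n)) atTop ≤ a) :
    ∀ᶠ p : ℕ × X in atTop ×ˢ 𝓝 x, fn p.1 p.2 < b := by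
  by_contra hcon
  obtain ⟨u, hu, hub⟩ := exists_seq_forall_of_frequently (not_eventually.mp hcon)
  obtain ⟨hu1, hu2⟩ := tendsto_prod_iff'.mp hu
  obtain ⟨σ, hσ, hmono⟩ := strictMono_subseq_of_tendsto_atTop hu1
  set N : ℕ → ℕ := fun k => (u (σ k)).1
  have hN : StrictMono N := hmono
  set y : ℕ → X := fun k => (u (σ k)).2
  have hy : Tendsto y atTop (𝓝 x) := hu2.comp hσ.tendsto_atTop
  set xs : ℕ → X := Function.extend N y fun _ => x
  have hxs : Tendsto xs atTop (𝓝 x) := by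
    intro U hU
    obtain ⟨K, hK⟩ := eventually_atTop.mp (hy hU)
    refine mem_map.mpr (mem_atTop_sets.mpr ⟨N K, fun n hn => ?_⟩)
    by_cases hr : ∃ j, N j = n
    · obtain ⟨j, rfl⟩ := hr
      simpa [xs, hN.injective.extend_apply] using hK j (hN.le_iff_le.mp hn)
    · simpa [xs, Function.extend_apply' _ _ _ hr] using mem_of_mem_nhds hU
  refine (hab.trans_le ?_).not_ge (h xs hxs)
  refine le_limsup_of_frequently_le ?_
    (isBoundedUnder_of ⟨M, fun n => (abs_le.mp (hbd n _)).2⟩)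
  refine hN.tendsto_atTop.frequently (Frequently.of_forall fun k => ?_)
  simpa [xs, hN.injective.extend_apply] using not_lt.mp (hub (σ k))

/-- The `k`-Lipschitz upper envelope of the tail `(fₙ)_{n ≥ k}`. -/
noncomputable def tailEnvelope {X : Type*} [PseudoMetricSpace X] (fn : ℕ → X → ℝ) (k : ℕ)
    (x : X) : ℝ :=
  ⨆ p : ℕ × X, (fn (k + p.1) p.2 - k * dist x p.2)

section tailEnvelope

variable {X : Type*} [PseudoMetricSpace X] {M : ℝ} {fn : ℕ → X → ℝ}

lemma bddAbove_tailEnvelope (hbd : ∀ n x, |fn n x| ≤ M) (k : ℕ) (x : X) :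
    BddAbove (Set.range fun p : ℕ × X => fn (k + p.1) p.2 - k * dist x p.2) := by
  refine ⟨M, ?_⟩
  rintro _ ⟨p, rfl⟩
  have h1 := (abs_le.mp (hbd (k + p.1) p.2)).2
  have h2 : 0 ≤ (k : ℝ) * dist x p.2 := by positivity
  linarith

lemma sub_le_tailEnvelope (hbd : ∀ n x, |fn n x| ≤ M) {k n : ℕ} (hkn : k ≤ n) (x y : X) :
    fn n y - k * dist x y ≤ tailEnvelope fn k x := by
  have h := le_ciSup (bddAbove_tailEnvelope hbd k x) (n - k, y)
  rwa [Nat.add_sub_cancel' hkn] at h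

lemma tailEnvelope_le {k : ℕ} {x : X} {c : ℝ}
    (h : ∀ n, k ≤ n → ∀ y, fn n y - k * dist x y ≤ c) : tailEnvelope fn k x ≤ c :=
  have : Nonempty X := ⟨x⟩
  ciSup_le fun p => h _ (Nat.le_add_right _ _) p.2

lemma le_tailEnvelope (hbd : ∀ n x, |fn n x| ≤ M) {k n : ℕ} (hkn : k ≤ n) (x : X) :
    fn n x ≤ tailEnvelope fn k x := by
  simpa using sub_le_tailEnvelope hbd hkn x x

lemma abs_tailEnvelope_le (hbd : ∀ n x, |fn n x| ≤ M) (k : ℕ) (x : X) :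
    |tailEnvelope fn k x| ≤ M := by
  refine abs_le.mpr ⟨(abs_le.mp (hbd k x)).1.trans (le_tailEnvelope hbd le_rfl x),
    tailEnvelope_le fun n _ y => ?_⟩
  have h1 := (abs_le.mp (hbd n y)).2
  have h2 : 0 ≤ (k : ℝ) * dist x y := by positivity
  linarith

lemma continuous_tailEnvelope (hbd : ∀ n x, |fn n x| ≤ M) (k : ℕ) :
    Continuous (tailEnvelope fn k) := by
  refine (LipschitzWith.of_le_add_mul (k : ℝ≥0) fun x y => ?_).continuous
  refine tailEnvelope_le fun n hn z => ?_
  have h1 := sub_le_tailEnvelope hbd hn y z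
  have h2 : (k : ℝ) * dist y z ≤ k * (dist x y + dist x z) := by
    gcongr
    exact dist_triangle_left y z x
  simp only [NNReal.coe_natCast]
  linarith

lemma antitone_tailEnvelope (hbd : ∀ n x, |fn n x| ≤ M) : Antitone (tailEnvelope fn) := by
  intro j k hjk x
  refine tailEnvelope_le fun n hn y => ?_
  refine le_trans ?_ (sub_le_tailEnvelope hbd (hjk.trans hn) x y)
  gcongr

lemma exists_tailEnvelope_le (hbd : ∀ n x, |fn n x| ≤ M) {x : X} {a b : ℝ} (hab : a < b)
    (h : ∀ xs : ℕ → X, Tendsto xs atTop (𝓝 x) → limsup (fun n => fn n (xs n)) atTop ≤ a) :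
    ∃ k, tailEnvelope fn k x ≤ b := by
  obtain ⟨P, hP, Q, hQ, hPQ⟩ :=
    eventually_prod_iff.mp (eventually_lt_of_forall_limsup_le hbd hab h)
  obtain ⟨k₀, hk₀⟩ := eventually_atTop.mp hP
  obtain ⟨δ, hδ, hδQ⟩ := Metric.eventually_nhds_iff.mp hQ
  obtain ⟨k₁, hk₁⟩ := exists_nat_ge (2 * M / δ)
  have hb : -M ≤ b := (abs_le.mp (hbd k₀ x)).1.trans (hPQ (hk₀ k₀ le_rfl) hQ.self_of_nhds).le
  refine ⟨max k₀ k₁, tailEnvelope_le fun n hn y => ?_⟩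
  rcases lt_or_ge (dist y x) δ with hy | hy
  · have h1 : fn n y < b := hPQ (hk₀ n ((le_max_left _ _).trans hn)) (hδQ hy)
    have h2 : 0 ≤ ((max k₀ k₁ : ℕ) : ℝ) * dist x y := by positivity
    linarith
  · have h1 := (abs_le.mp (hbd n y)).2
    have h2 : (k₁ : ℝ) * δ ≤ ((max k₀ k₁ : ℕ) : ℝ) * dist x y := by
      rw [dist_comm x y]
      gcongr
      exact le_max_right _ _
    have h3 := (div_le_iff₀ hδ).mp hk₁
    linarith

end tailEnvelope

/-- If Borel probability measures `μₙ` converge weakly to `μ` on a metric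
space `X`, `fₙ` are Borel functions with `|fₙ| ≤ M`, `f` is Borel, and
`limsupₙ fₙ(xₙ) ≤ f(x)` whenever `xₙ → x`, then `limsupₙ ∫ fₙ dμₙ ≤ ∫ f dμ`, where the
right-hand integral (well defined in `(-∞,∞]` since `f ≥ -M`) is expressed as
`∫⁻ (f + M) dμ - M` in the extended reals. -/
theorem stmt4 {X : Type*} [MetricSpace X] [MeasurableSpace X] [BorelSpace X]
    (μs : ℕ → Measure X) (μ : Measure X)
    (hμs : ∀ n, IsProbabilityMeasure (μs n)) (hμ : IsProbabilityMeasure μ)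
    (hweak : ∀ φ : X → ℝ, Continuous φ → (∃ C, ∀ x, |φ x| ≤ C) →
      Tendsto (fun n => ∫ x, φ x ∂ μs n) atTop (𝓝 (∫ x, φ x ∂ μ)))
    (M : ℝ) (hM : 0 ≤ M)
    (fn : ℕ → X → ℝ) (hfn : ∀ n, Measurable (fn n)) (hbd : ∀ n x, |fn n x| ≤ M)
    (f : X → ℝ) (hf : Measurable f)
    (husc : ∀ (x : X) (xs : ℕ → X), Tendsto xs atTop (𝓝 x) →
      limsup (fun n => fn n (xs n)) atTop ≤ f x) :
    ((limsup (fun n => ∫ x, fn n x ∂ μs n) atTop : ℝ) : EReal) ≤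
      ((∫⁻ x, ENNReal.ofReal (f x + M) ∂ μ : ℝ≥0∞) : EReal) - (M : EReal) := by
  set φ : ℕ → X → ℝ := tailEnvelope fn
  have hφc : ∀ k, Continuous (φ k) := continuous_tailEnvelope hbd
  have hφb : ∀ k x, |φ k x| ≤ M := abs_tailEnvelope_le hbd
  have hφi : ∀ (ν : Measure X) [IsProbabilityMeasure ν] (k : ℕ), Integrable (φ k) ν :=
    fun ν _ k => .of_bound (hφc k).measurable.aestronglyMeasurable M (.of_forall (hφb k))
  set L : ℝ := limsup (fun n => ∫ x, fn n x ∂ μs n) atTop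
  have hL : ∀ k, L ≤ ∫ x, φ k x ∂ μ := by
    intro k
    have ht := hweak (φ k) (hφc k) ⟨M, hφb k⟩
    rw [← ht.limsup_eq]
    refine limsup_le_limsup ?_ ?_ ht.isBoundedUnder_le
    · filter_upwards [eventually_ge_atTop k] with n hn
      have hfi : Integrable (fn n) (μs n) :=
        .of_bound (hfn n).aestronglyMeasurable M (.of_forall (hbd n))
      exact integral_mono hfi (hφi (μs n) k) fun x => le_tailEnvelope hbd hn x
    · refine IsBoundedUnder.isCoboundedUnder_le (isBoundedUnder_of ⟨-M, fun n => ?_⟩)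
      have h := norm_integral_le_of_norm_le_const (μ := μs n) (f := fn n) (.of_forall (hbd n))
      rw [probReal_univ, mul_one] at h
      exact (abs_le.mp h).1
  have hint : ∀ k, ∫⁻ x, ENNReal.ofReal (φ k x + M) ∂ μ
      = ENNReal.ofReal (∫ x, φ k x ∂ μ + M) := by
    intro k
    have hadd : Integrable (fun x => φ k x + M) μ := (hφi μ k).add (integrable_const M)
    have hnonneg : ∀ x, 0 ≤ φ k x + M := fun x => by
      linarith [(abs_le.mp (hφb k x)).1]
    rw [← ofReal_integral_eq_lintegral_ofReal hadd (.of_forall hnonneg),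
      integral_add (hφi μ k) (integrable_const M)]
    simp
  have hle : ENNReal.ofReal (L + M) ≤ ∫⁻ x, ENNReal.ofReal (f x + M) ∂ μ := calc
    ENNReal.ofReal (L + M) ≤ ⨅ k, ∫⁻ x, ENNReal.ofReal (φ k x + M) ∂ μ := by
      refine le_iInf fun k => ?_
      rw [hint]
      gcongr
      exact hL k
    _ = ∫⁻ x, ⨅ k, ENNReal.ofReal (φ k x + M) ∂ μ := by
      refine (lintegral_iInf (fun k => ?_) (fun j k hjk x => ?_) ?_).symm
      · exact ((hφc k).measurable.add_const M).ennreal_ofReal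
      · have h : φ k x ≤ φ j x := antitone_tailEnvelope hbd hjk x
        dsimp only
        gcongr
      · rw [hint]
        exact ENNReal.ofReal_ne_top
    _ ≤ ∫⁻ x, ENNReal.ofReal (f x + M) ∂ μ := by
      refine lintegral_mono fun x => ENNReal.le_of_forall_pos_le_add fun ε hε _ => ?_
      obtain ⟨k, hk⟩ := exists_tailEnvelope_le hbd
        (lt_add_of_pos_right (f x) (NNReal.coe_pos.mpr hε)) (husc x)
      calc ⨅ k, ENNReal.ofReal (φ k x + M) ≤ ENNReal.ofReal (φ k x + M) := iInf_le _ k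
        _ ≤ ENNReal.ofReal ((f x + M) + ε) := ENNReal.ofReal_le_ofReal (by
            have : φ k x ≤ f x + ε := hk
            linarith)
        _ ≤ ENNReal.ofReal (f x + M) + ENNReal.ofReal ε := ENNReal.ofReal_add_le
        _ = ENNReal.ofReal (f x + M) + ε := by rw [ENNReal.ofReal_coe_nnreal]
  rw [EReal.le_sub_iff_add_le (.inl (EReal.coe_ne_bot M)) (.inl (EReal.coe_ne_top M)),
    ← EReal.coe_add]
  refine le_trans ?_ (EReal.coe_ennreal_le_coe_ennreal_iff.mpr hle)
  rw [EReal.coe_ennreal_ofReal]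
  exact EReal.coe_le_coe_iff.mpr (le_max_left _ _)
end

section
/- Let (X,d) be a length metric space and let φ : X → ℝ be Lipschitz. Then for every x ∈ X the asymptotic Lipschitz constant satisfies |D*φ|(x) = limsup_{y→x} |Dφ|(y). -/
open Filter Topology
open scoped ENNReal NNReal

/-- The slope `|Df|(x) = limsup_{y→x} |f(y)-f(x)|/d(y,x)` (junk value `0` at isolated
points, where the punctured neighbourhood filter is trivial). -/
noncomputable def slopeAt {X : Type*} [MetricSpace X] (f : X → ℝ) (x : X) : ℝ :=
  limsup (fun y => |f y - f x| / dist y x) (𝓝[≠] x)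

/-- The asymptotic Lipschitz constant
`|D*f|(x) = limsup_{y,z→x, y≠z} |f(y)-f(z)|/d(y,z)`. -/
noncomputable def asympLipAt {X : Type*} [MetricSpace X] (f : X → ℝ) (x : X) : ℝ :=
  limsup (fun p : X × X => |f p.1 - f p.2| / dist p.1 p.2)
    (𝓝[{p : X × X | p.1 ≠ p.2}] (x, x))

/-- `(X,d)` is a length space: `d(x,y)` is the infimum of the lengths of Lipschitz curves
`γ : [0,1] → X` from `x` to `y`, where the length is the supremum over partitions of sums of
distances of consecutive points (i.e. the total variation of `γ` on `[0,1]`). -/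
def IsLengthSpace (X : Type*) [MetricSpace X] : Prop :=
  ∀ x y : X,
    ENNReal.ofReal (dist x y) =
      ⨅ (γ : ℝ → X) (_ : ∃ L : ℝ≥0, LipschitzOnWith L γ (Set.Icc 0 1)) (_ : γ 0 = x)
        (_ : γ 1 = y), eVariationOn γ (Set.Icc 0 1)

theorem limsup_le_of_nonneg {α : Type*} {l : Filter α} {u : α → ℝ} {c : ℝ}
    (hu : ∀ a, 0 ≤ u a) (hc : 0 ≤ c) (h : ∀ᶠ a in l, u a ≤ c) : limsup u l ≤ c := by
  rcases l.eq_or_neBot with rfl | hl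
  · simpa [limsup, limsSup] using hc
  · exact limsup_le_of_le (isCoboundedUnder_le_of_le l hu) h

theorem limsup_nonneg_of_le {α : Type*} {l : Filter α} {u : α → ℝ} {K : ℝ}
    (hu : ∀ a, 0 ≤ u a) (hK : ∀ a, u a ≤ K) : 0 ≤ limsup u l := by
  rcases l.eq_or_neBot with rfl | hl
  · simp [limsup, limsSup]
  · exact le_limsup_of_le (isBoundedUnder_of ⟨K, hK⟩) fun b hb =>
      let ⟨a, ha⟩ := hb.exists
      (hu a).trans ha

section Slope

variable {X : Type*} [MetricSpace X] {f : X → ℝ}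

theorem LipschitzWith.abs_sub_div_dist_le {L : ℝ≥0} (hf : LipschitzWith L f) (y z : X) :
    |f y - f z| / dist y z ≤ L :=
  div_le_of_le_mul₀ dist_nonneg L.2 (by simpa [Real.dist_eq] using hf.dist_le_mul y z)

theorem abs_sub_div_dist_nonneg (f : X → ℝ) (y z : X) : 0 ≤ |f y - f z| / dist y z := by
  positivity

theorem slopeAt_nonneg {L : ℝ≥0} (hf : LipschitzWith L f) (y : X) : 0 ≤ slopeAt f y :=
  limsup_nonneg_of_le (fun z => abs_sub_div_dist_nonneg f z y)
    fun z => hf.abs_sub_div_dist_le z y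

theorem slopeAt_le {y : X} {c : ℝ} (hc : 0 ≤ c)
    (h : ∀ᶠ z in 𝓝 y, |f z - f y| ≤ c * dist z y) : slopeAt f y ≤ c :=
  limsup_le_of_nonneg (fun z => abs_sub_div_dist_nonneg f z y) hc <|
    (h.filter_mono nhdsWithin_le_nhds).mono fun _ hz => div_le_of_le_mul₀ dist_nonneg hc hz

theorem LipschitzWith.slopeAt_le {L : ℝ≥0} (hf : LipschitzWith L f) (y : X) :
    slopeAt f y ≤ L :=
  _root_.slopeAt_le L.2 <| .of_forall fun z => by
    simpa [Real.dist_eq] using hf.dist_le_mul z y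

theorem abs_sub_le_mul_dist_of_div_lt {c : ℝ} {y z : X}
    (h : y ≠ z → |f y - f z| / dist y z < c) : |f y - f z| ≤ c * dist y z := by
  by_cases hyz : y = z
  · simp [hyz]
  · exact ((div_lt_iff₀ (dist_pos.2 hyz)).1 (h hyz)).le

theorem eventually_edist_le_of_slopeAt_lt {L : ℝ≥0} (hf : LipschitzWith L f) {y : X} {c : ℝ≥0}
    (h : slopeAt f y < c) : ∀ᶠ z in 𝓝 y, edist (f z) (f y) ≤ c * edist z y := by
  have h' := eventually_lt_of_limsup_lt h
    (isBoundedUnder_of ⟨(L : ℝ), fun z => hf.abs_sub_div_dist_le z y⟩)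
  filter_upwards [eventually_nhdsWithin_iff.1 h'] with z hz
  have := abs_sub_le_mul_dist_of_div_lt hz
  rw [← Real.dist_eq] at this
  rw [edist_nndist, edist_nndist]
  exact_mod_cast this

theorem asympLipAt_nonneg {L : ℝ≥0} (hf : LipschitzWith L f) (x : X) : 0 ≤ asympLipAt f x :=
  limsup_nonneg_of_le (fun p => abs_sub_div_dist_nonneg f p.1 p.2)
    fun p => hf.abs_sub_div_dist_le p.1 p.2

theorem asympLipAt_le {x : X} {c : ℝ≥0} {U : Set X} (hU : U ∈ 𝓝 x)
    (h : ∀ y ∈ U, ∀ z ∈ U, edist (f y) (f z) ≤ c * edist y z) : asympLipAt f x ≤ c := by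
  refine limsup_le_of_nonneg (fun p => abs_sub_div_dist_nonneg f p.1 p.2) c.2 ?_
  filter_upwards [nhdsWithin_le_nhds (prod_mem_nhds hU hU)] with p hp
  refine div_le_of_le_mul₀ dist_nonneg c.2 ?_
  have := h p.1 hp.1 p.2 hp.2
  rw [edist_nndist, edist_nndist] at this
  rw [← Real.dist_eq]
  exact_mod_cast this

theorem eventually_slopeAt_le_of_asympLipAt_lt {L : ℝ≥0} (hf : LipschitzWith L f) {x : X} {c : ℝ}
    (h : asympLipAt f x < c) : ∀ᶠ y in 𝓝 x, slopeAt f y ≤ c := by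
  have h' := eventually_lt_of_limsup_lt h
    (isBoundedUnder_of ⟨(L : ℝ), fun p => hf.abs_sub_div_dist_le p.1 p.2⟩)
  rw [eventually_nhdsWithin_iff] at h'
  have hc : 0 ≤ c := (asympLipAt_nonneg hf x).trans h.le
  have hdiag : Tendsto (fun y : X => (y, y)) (𝓝 x) (𝓝 (x, x)) :=
    Continuous.tendsto (by fun_prop) x
  filter_upwards [hdiag.eventually (eventually_eventually_nhds.2 h')] with y hy
  have hleft : Tendsto (fun z : X => (z, y)) (𝓝 y) (𝓝 (y, y)) :=
    Continuous.tendsto (by fun_prop) y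
  exact slopeAt_le hc <| (hleft.eventually hy).mono fun z hz => abs_sub_le_mul_dist_of_div_lt hz

end Slope

/-- A function which is, to the right of every point, locally `c`-Lipschitz relative to a curve `γ`
varies by at most `c` times the length of `γ`. -/
theorem edist_le_mul_eVariationOn {X Y : Type*} [PseudoEMetricSpace X] [PseudoEMetricSpace Y]
    {γ : ℝ → X} {g : ℝ → Y} {a b : ℝ} (hab : a ≤ b) (hg : ContinuousOn g (Set.Icc a b)) {c : ℝ≥0∞}
    (h : ∀ t ∈ Set.Ico a b, ∀ᶠ s in 𝓝[>] t, edist (g s) (g t) ≤ c * edist (γ s) (γ t)) :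
    edist (g b) (g a) ≤ c * eVariationOn γ (Set.Icc a b) := by
  set S := {t ∈ Set.Icc a b | edist (g t) (g a) ≤ c * eVariationOn γ (Set.Icc a t)} with hS
  have ha : a ∈ S := ⟨Set.left_mem_Icc.2 hab, by simp⟩
  have hbdd : BddAbove S := ⟨b, fun t ht => ht.1.2⟩
  set T := sSup S
  have haT : a ≤ T := le_csSup hbdd ha
  have hTb : T ≤ b := csSup_le ⟨a, ha⟩ fun t ht => ht.1.2
  have hTS : T ∈ S := by
    refine ⟨⟨haT, hTb⟩, ?_⟩
    have hcl : T ∈ closure S := csSup_mem_closure ⟨a, ha⟩ hbdd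
    have : (𝓝[S] T).NeBot := mem_closure_iff_nhdsWithin_neBot.1 hcl
    have hlim : Tendsto g (𝓝[S] T) (𝓝 (g T)) :=
      (hg T ⟨haT, hTb⟩).mono fun t ht => ht.1
    refine le_of_tendsto (hlim.edist tendsto_const_nhds) ?_
    filter_upwards [self_mem_nhdsWithin] with t ht
    refine ht.2.trans ?_
    gcongr
    exact eVariationOn.mono γ (Set.Icc_subset_Icc_right (le_csSup hbdd ht))
  rcases hTb.eq_or_lt with hT | hT
  · exact hT ▸ hTS.2
  obtain ⟨s, hs, hTs, hsb⟩ := ((h T ⟨haT, hT⟩).and (Ioc_mem_nhdsGT hT)).exists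
  refine absurd (le_csSup hbdd (?_ : s ∈ S)) hTs.not_ge
  refine ⟨⟨haT.trans hTs.le, hsb⟩, ?_⟩
  calc edist (g s) (g a) ≤ edist (g s) (g T) + edist (g T) (g a) := edist_triangle _ _ _
    _ ≤ c * eVariationOn γ (Set.Icc T s) + c * eVariationOn γ (Set.Icc a T) := by
      refine add_le_add (hs.trans ?_) hTS.2
      gcongr
      exact eVariationOn.edist_le γ (Set.right_mem_Icc.2 hTs.le) (Set.left_mem_Icc.2 hTs.le)
    _ = c * eVariationOn γ (Set.Icc a s) := by
      have := eVariationOn.Icc_add_Icc γ (s := Set.univ) haT hTs.le (Set.mem_univ _)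
      simp only [Set.univ_inter] at this
      rw [← this, mul_add, add_comm]

namespace IsLengthSpace

variable {X : Type*} [MetricSpace X] {Y : Type*} [PseudoEMetricSpace Y] {f : X → Y} {c : ℝ≥0}

/-- To bound `f` by `c * edist` it suffices to bound it by `c` times the length along
sufficiently short curves. -/
theorem edist_le_of_forall_curve (hX : IsLengthSpace X) {y z : X} {ρ : ℝ≥0∞} (hρ : edist y z < ρ)
    (h : ∀ γ : ℝ → X, ContinuousOn γ (Set.Icc 0 1) → γ 0 = y → γ 1 = z →
      eVariationOn γ (Set.Icc 0 1) < ρ →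
      edist (f y) (f z) ≤ c * eVariationOn γ (Set.Icc 0 1)) :
    edist (f y) (f z) ≤ c * edist y z := by
  by_contra! hlt
  have hcont : Tendsto (fun l : ℝ≥0∞ => c * l) (𝓝 (edist y z)) (𝓝 (c * edist y z)) :=
    ENNReal.Tendsto.const_mul tendsto_id (Or.inr ENNReal.coe_ne_top)
  have hev : ∀ᶠ l in 𝓝 (edist y z), c * l < edist (f y) (f z) ∧ l < ρ :=
    (hcont.eventually_lt_const hlt).and (eventually_lt_nhds hρ)
  have : (𝓝[>] edist y z).NeBot := nhdsGT_neBot_of_exists_gt ⟨ρ, hρ⟩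
  obtain ⟨l, ⟨hl, hlρ⟩, hyl⟩ :=
    ((hev.filter_mono nhdsWithin_le_nhds).and (self_mem_nhdsWithin (s := Set.Ioi (edist y z)))).exists
  rw [edist_dist, hX y z] at hyl
  simp only [iInf_lt_iff] at hyl
  obtain ⟨γ, ⟨L, hL⟩, h0, h1, hγ⟩ := hyl
  refine (h γ hL.continuousOn h0 h1 (hγ.trans hlρ)).not_gt (lt_of_le_of_lt ?_ hl)
  gcongr

theorem edist_le_of_punctured (hX : IsLengthSpace X) (hf : Continuous f) {x z : X} {r : ℝ≥0∞}
    (h : ∀ w ∈ Metric.eball x r, w ≠ x → ∀ᶠ v in 𝓝 w, edist (f v) (f w) ≤ c * edist v w)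
    (hz : z ∈ Metric.eball x r) : edist (f z) (f x) ≤ c * edist z x := by
  refine hX.edist_le_of_forall_curve hz fun γ hγ h0 h1 hlen => ?_
  set S := Set.Icc (0 : ℝ) 1 ∩ γ ⁻¹' {x}
  have hScl : IsClosed S := hγ.preimage_isClosed_of_isClosed isClosed_Icc isClosed_singleton
  have hSb : BddBelow S := ⟨0, fun t ht => ht.1.1⟩
  obtain ⟨⟨hT0, hT1⟩, hTx⟩ : sInf S ∈ S :=
    hScl.csInf_mem ⟨1, Set.right_mem_Icc.2 zero_le_one, h1⟩ hSb
  set T := sInf S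
  have hsub : Set.Icc 0 T ⊆ Set.Icc 0 1 := Set.Icc_subset_Icc_right hT1
  have key := edist_le_mul_eVariationOn (γ := γ) (g := f ∘ γ) (c := c) hT0
    (hf.comp_continuousOn (hγ.mono hsub)) fun t ht => ?_
  · rw [edist_comm]
    simp only [Function.comp_apply, h0, show γ T = x from hTx] at key
    exact key.trans (by gcongr; exact eVariationOn.mono γ hsub)
  · have ht1 : t ∈ Set.Icc (0 : ℝ) 1 := hsub (Set.Ico_subset_Icc_self ht)
    have hball : γ t ∈ Metric.eball x r := by
      have := eVariationOn.edist_le γ ht1 (Set.right_mem_Icc.2 (zero_le_one (α := ℝ)))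
      rw [h1] at this
      exact this.trans_lt hlen
    have hne : γ t ≠ x := fun hx => (csInf_le hSb ⟨ht1, hx⟩).not_gt ht.2
    have hlim : Tendsto γ (𝓝[>] t) (𝓝 (γ t)) :=
      (hγ t ht1).mono_left (nhdsWithin_le_of_mem (mem_of_superset
        (Ioc_mem_nhdsGT (ht.2.trans_le hT1)) fun s hs => ⟨ht.1.trans hs.1.le, hs.2⟩))
    exact hlim.eventually (h _ hball hne)

theorem edist_le_of_mem_eball (hX : IsLengthSpace X) (hf : Continuous f) {x y z : X} {r : ℝ≥0∞}
    (h : ∀ w ∈ Metric.eball x (r + 2 * r), ∀ᶠ v in 𝓝 w, edist (f v) (f w) ≤ c * edist v w)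
    (hy : y ∈ Metric.eball x r) (hz : z ∈ Metric.eball x r) :
    edist (f y) (f z) ≤ c * edist y z := by
  have hyz : edist y z < 2 * r := by
    rw [two_mul]
    exact (edist_triangle_right y z x).trans_lt (ENNReal.add_lt_add hy hz)
  refine hX.edist_le_of_forall_curve hyz fun γ hγ h0 h1 hlen => ?_
  have key := edist_le_mul_eVariationOn (γ := γ) (g := f ∘ γ) (c := c) zero_le_one
    (hf.comp_continuousOn hγ) fun t ht => ?_
  · simpa [edist_comm, h0, h1] using key
  · have ht1 := Set.Ico_subset_Icc_self ht
    have hball : γ t ∈ Metric.eball x (r + 2 * r) := by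
      have := eVariationOn.edist_le γ ht1 (Set.left_mem_Icc.2 (zero_le_one (α := ℝ)))
      rw [h0] at this
      rw [Metric.mem_eball, add_comm]
      exact (edist_triangle _ y x).trans_lt (ENNReal.add_lt_add (this.trans_lt hlen) hy)
    have hlim : Tendsto γ (𝓝[>] t) (𝓝 (γ t)) :=
      (hγ t ht1).mono_left (nhdsWithin_le_of_mem (mem_of_superset
        (Ioc_mem_nhdsGT ht.2) fun s hs => ⟨ht.1.trans hs.1.le, hs.2⟩))
    exact hlim.eventually (h _ hball)

end IsLengthSpace

/-- In a length metric space, for a Lipschitz function `φ` the asymptotic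
Lipschitz constant satisfies `|D*φ|(x) = limsup_{y→x} |Dφ|(y)`. -/
theorem stmt5 {X : Type*} [MetricSpace X] (hX : IsLengthSpace X)
    (φ : X → ℝ) (hφ : ∃ L : ℝ≥0, LipschitzWith L φ) (x : X) :
    asympLipAt φ x = limsup (fun y => slopeAt φ y) (𝓝[≠] x) := by
  obtain ⟨L, hL⟩ := hφ
  have hnonneg : 0 ≤ limsup (fun y => slopeAt φ y) (𝓝[≠] x) :=
    limsup_nonneg_of_le (slopeAt_nonneg hL) hL.slopeAt_le
  refine le_antisymm (le_of_forall_gt_imp_ge_of_dense fun c hc => ?_)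
    (le_of_forall_gt_imp_ge_of_dense fun c hc => ?_)
  · lift c to ℝ≥0 using hnonneg.trans hc.le
    have hev := eventually_nhdsWithin_iff.1 <| eventually_lt_of_limsup_lt hc
      (isBoundedUnder_of ⟨(L : ℝ), hL.slopeAt_le⟩)
    obtain ⟨r, hr, hball⟩ := EMetric.mem_nhds_iff.1 hev
    have hpunct : ∀ w ∈ Metric.eball x r, w ≠ x →
        ∀ᶠ v in 𝓝 w, edist (φ v) (φ w) ≤ c * edist v w :=
      fun w hw hwx => eventually_edist_le_of_slopeAt_lt hL (hball hw hwx)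
    have hfull : ∀ w ∈ Metric.eball x r, ∀ᶠ v in 𝓝 w, edist (φ v) (φ w) ≤ c * edist v w := by
      intro w hw
      by_cases hwx : w = x
      · subst hwx
        filter_upwards [Metric.eball_mem_nhds w hr] with v hv
        exact hX.edist_le_of_punctured hL.continuous hpunct hv
      · exact hpunct w hw hwx
    have hr3 : r / 3 + 2 * (r / 3) = r := by
      rw [← one_add_mul, show (1 + 2 : ℝ≥0∞) = 3 by norm_num]
      exact ENNReal.mul_div_cancel (by norm_num) (by norm_num)
    exact asympLipAt_le (Metric.eball_mem_nhds x (ENNReal.div_pos hr.ne' ENNReal.ofNat_ne_top))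
      fun y hy z hz => hX.edist_le_of_mem_eball hL.continuous (by rwa [hr3]) hy hz
  · exact limsup_le_of_nonneg (slopeAt_nonneg hL) ((asympLipAt_nonneg hL x).trans hc.le)
      ((eventually_slopeAt_le_of_asympLipAt_lt hL hc).filter_mono nhdsWithin_le_nhds)
end

section
/- Let (X,d) be a nonempty length metric space and let φ : X → ℝ be Lipschitz. Then the least Lipschitz constant Lip(φ) of φ satisfies Lip(φ) = sup_{x∈X} |Dφ|(x) = sup_{x∈X} |D*φ|(x). -/
open Filter Topology
open scoped ENNReal NNReal

/-- The least Lipschitz constant of a real function on a metric space. -/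
noncomputable def lipConst {X : Type*} [MetricSpace X] (φ : X → ℝ) : ℝ :=
  sInf {L : ℝ | 0 ≤ L ∧ ∀ x y : X, |φ y - φ x| ≤ L * dist x y}

theorem continuousOn_variationOnFromTo_of_lipschitzOnWith {E : Type*} [PseudoEMetricSpace E]
    {γ : ℝ → E} {s : Set ℝ} {K : ℝ≥0} (hγ : LipschitzOnWith K γ s) {a : ℝ} (ha : a ∈ s) :
    ContinuousOn (variationOnFromTo γ s a) s := by
  have hv := hγ.locallyBoundedVariationOn
  refine (LipschitzOnWith.of_le_add_mul K fun y hy x hx => ?_).continuousOn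
  rcases le_total y x with h | h
  · have := variationOnFromTo.monotoneOn hv ha hy hx h
    have : 0 ≤ (K : ℝ) * dist y x := by positivity
    linarith
  · rw [← variationOnFromTo.add hv ha hx hy, variationOnFromTo.eq_of_le _ _ h]
    have h₁ : eVariationOn γ (s ∩ Set.Icc x y) ≤ K * ENNReal.ofReal (y - x) :=
      (hγ.comp_eVariationOn_le (g := id) fun _ ht => ht.1).trans
        (mul_le_mul_right (monotoneOn_id.eVariationOn_eq hx hy).le _)
    have h₂ := ENNReal.toReal_mono (by finiteness) h₁
    rw [ENNReal.toReal_mul, ENNReal.toReal_ofReal (sub_nonneg.2 h)] at h₂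
    rw [Real.dist_eq, abs_of_nonneg (sub_nonneg.2 h)]
    simpa using h₂

theorem abs_sub_le_mul_eVariationOn_of_eventually {X : Type*} [MetricSpace X] {φ : X → ℝ}
    (hφ : Continuous φ) {S : ℝ} (hS : 0 ≤ S)
    (hloc : ∀ x, ∀ᶠ y in 𝓝 x, |φ y - φ x| ≤ S * dist y x)
    {γ : ℝ → X} {K : ℝ≥0} (hγ : LipschitzOnWith K γ (Set.Icc 0 1)) :
    |φ (γ 1) - φ (γ 0)| ≤ S * (eVariationOn γ (Set.Icc 0 1)).toReal := by
  set I : Set ℝ := Set.Icc 0 1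
  have h0 : (0 : ℝ) ∈ I := by simp [I]
  have h1 : (1 : ℝ) ∈ I := by simp [I]
  have hv := hγ.locallyBoundedVariationOn
  have hc : IsClosed {t ∈ I | |φ (γ t) - φ (γ 0)| ≤ S * variationOnFromTo γ I 0 t} :=
    isClosed_Icc.isClosed_le
      ((hφ.comp_continuousOn hγ.continuousOn).sub continuousOn_const).abs
      (continuousOn_const.mul (continuousOn_variationOnFromTo_of_lipschitzOnWith hγ h0))
  have key : I ⊆ {t | |φ (γ t) - φ (γ 0)| ≤ S * variationOnFromTo γ I 0 t} := by
    refine IsClosed.Icc_subset_of_forall_mem_nhdsWithin ?_ ?_ ?_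
    · rwa [Set.inter_comm]
    · simp [variationOnFromTo.self]
    · rintro t ⟨ht, ht0, ht1⟩
      have htI : t ∈ I := ⟨ht0, ht1.le⟩
      have hIoc : Set.Ioc t 1 ∈ 𝓝[>] t := Ioc_mem_nhdsGT ht1
      have htend : Tendsto γ (𝓝[>] t) (𝓝 (γ t)) :=
        (hγ.continuousOn t htI).tendsto.mono_left
          (nhdsWithin_le_of_mem (mem_of_superset hIoc fun u hu => ⟨ht0.trans hu.1.le, hu.2⟩))
      filter_upwards [htend.eventually (hloc (γ t)), hIoc] with u hu hut
      have huI : u ∈ I := ⟨ht0.trans hut.1.le, hut.2⟩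
      have hd : dist (γ u) (γ t) ≤ variationOnFromTo γ I t u := by
        rw [variationOnFromTo.eq_of_le _ _ hut.1.le, dist_edist]
        exact ENNReal.toReal_mono (hv t u htI huI)
          (eVariationOn.edist_le γ ⟨huI, hut.1.le, le_rfl⟩ ⟨htI, le_rfl, hut.1.le⟩)
      simp only [Set.mem_ofPred_eq] at ht ⊢
      rw [← variationOnFromTo.add hv h0 htI huI, mul_add]
      have := abs_sub_le (φ (γ u)) (φ (γ t)) (φ (γ 0))
      have := mul_le_mul_of_nonneg_left hd hS
      linarith
  have := key h1
  rwa [Set.mem_ofPred_eq, variationOnFromTo.eq_of_le _ _ zero_le_one, Set.inter_self] at this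

theorem IsLengthSpace.abs_sub_le_of_eventually {X : Type*} [MetricSpace X] (hX : IsLengthSpace X)
    {φ : X → ℝ} (hφ : Continuous φ) {S : ℝ} (hS : 0 ≤ S)
    (hloc : ∀ x, ∀ᶠ y in 𝓝 x, |φ y - φ x| ≤ S * dist y x) (x y : X) :
    |φ y - φ x| ≤ S * dist x y := by
  have hε : ∀ ε > 0, |φ y - φ x| ≤ S * (dist x y + ε) := by
    intro ε hε
    have h : ENNReal.ofReal (dist x y) < ENNReal.ofReal (dist x y + ε) :=
      (ENNReal.ofReal_lt_ofReal_iff (by positivity)).2 (by linarith)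
    rw [hX x y] at h
    simp only [iInf_lt_iff] at h
    obtain ⟨γ, ⟨K, hγ⟩, rfl, rfl, hlt⟩ := h
    refine (abs_sub_le_mul_eVariationOn_of_eventually hφ hS hloc hγ).trans ?_
    exact mul_le_mul_of_nonneg_left
      (ENNReal.toReal_le_of_le_ofReal (by positivity) hlt.le) hS
  have hlim : Tendsto (fun ε => S * (dist x y + ε)) (𝓝[>] 0) (𝓝 (S * dist x y)) := by
    have : Continuous fun ε => S * (dist x y + ε) := by fun_prop
    simpa using (this.tendsto 0).mono_left nhdsWithin_le_nhds
  exact ge_of_tendsto hlim (eventually_mem_nhdsWithin.mono hε)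

theorem limsup_nonneg_of_nonneg {α : Type*} {l : Filter α} {u : α → ℝ} (hu : ∀ a, 0 ≤ u a)
    (hb : l.IsBoundedUnder (· ≤ ·) u) : 0 ≤ limsup u l := by
  rcases l.eq_or_neBot with rfl | _
  · simp [limsup, limsSup]
  · exact le_limsup_of_frequently_le (Frequently.of_forall hu) hb

theorem limsup_le_of_forall_le {α : Type*} {l : Filter α} {u : α → ℝ} {C : ℝ} (hC : 0 ≤ C)
    (hu : ∀ a, 0 ≤ u a) (huC : ∀ a, u a ≤ C) : limsup u l ≤ C := by
  rcases l.eq_or_neBot with rfl | _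
  · simpa [limsup, limsSup] using hC
  · exact limsup_le_of_le (isBoundedUnder_of ⟨0, hu⟩).isCoboundedUnder_le (.of_forall huC)

section Slopes

variable {X : Type*} [MetricSpace X] {φ : X → ℝ} {L : ℝ}

theorem abs_sub_div_dist_le (hL : 0 ≤ L) (h : ∀ x y, |φ y - φ x| ≤ L * dist x y) (x y : X) :
    |φ y - φ x| / dist y x ≤ L :=
  div_le_of_le_mul₀ dist_nonneg hL (by rw [dist_comm]; exact h x y)

theorem slopeAt_nonneg_s6 (hL : 0 ≤ L) (h : ∀ x y, |φ y - φ x| ≤ L * dist x y) (x : X) :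
    0 ≤ slopeAt φ x :=
  limsup_nonneg_of_nonneg (fun _ => by positivity)
    (isBoundedUnder_of ⟨L, abs_sub_div_dist_le hL h x⟩)

theorem asympLipAt_le_s6 (hL : 0 ≤ L) (h : ∀ x y, |φ y - φ x| ≤ L * dist x y) (x : X) :
    asympLipAt φ x ≤ L :=
  limsup_le_of_forall_le hL (fun _ => by positivity) fun p => abs_sub_div_dist_le hL h p.2 p.1

theorem slopeAt_le_asympLipAt (hL : 0 ≤ L) (h : ∀ x y, |φ y - φ x| ≤ L * dist x y) (x : X) :
    slopeAt φ x ≤ asympLipAt φ x := by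
  have hb : (𝓝[{p : X × X | p.1 ≠ p.2}] (x, x)).IsBoundedUnder (· ≤ ·)
      fun p : X × X => |φ p.1 - φ p.2| / dist p.1 p.2 :=
    isBoundedUnder_of ⟨L, fun p => abs_sub_div_dist_le hL h p.2 p.1⟩
  rcases (𝓝[≠] x).eq_or_neBot with hx | _
  · have h0 : slopeAt φ x = 0 := by simp [slopeAt, hx, limsup, limsSup]
    rw [h0]
    exact limsup_nonneg_of_nonneg (fun _ => by positivity) hb
  · have ht : Tendsto (fun y => (y, x)) (𝓝[≠] x) (𝓝[{p : X × X | p.1 ≠ p.2}] (x, x)) := by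
      refine tendsto_nhdsWithin_iff.2 ⟨?_, self_mem_nhdsWithin⟩
      have : Continuous fun y : X => (y, x) := by fun_prop
      exact (this.tendsto x).mono_left nhdsWithin_le_nhds
    refine limsup_le_limsup_of_le (f := map (fun y => (y, x)) (𝓝[≠] x))
      (u := fun p : X × X => |φ p.1 - φ p.2| / dist p.1 p.2) ht ?_ hb
    exact (isBoundedUnder_of ⟨0, fun _ => by positivity⟩).isCoboundedUnder_le

theorem eventually_abs_sub_le_of_slopeAt_lt (hL : 0 ≤ L)
    (h : ∀ x y, |φ y - φ x| ≤ L * dist x y) {S : ℝ} {x : X} (hS : slopeAt φ x < S) :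
    ∀ᶠ y in 𝓝 x, |φ y - φ x| ≤ S * dist y x := by
  have := eventually_lt_of_limsup_lt hS (isBoundedUnder_of ⟨L, abs_sub_div_dist_le hL h x⟩)
  rw [eventually_nhdsWithin_iff] at this
  filter_upwards [this] with y hy
  rcases eq_or_ne y x with rfl | hyx
  · simp
  · exact ((div_lt_iff₀ (dist_pos.2 hyx)).1 (hy hyx)).le

theorem IsLengthSpace.lipConst_le_of_slopeAt_le (hX : IsLengthSpace X) (hφ : Continuous φ)
    (hL : 0 ≤ L) (h : ∀ x y, |φ y - φ x| ≤ L * dist x y) {S : ℝ} (hS : 0 ≤ S)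
    (hslope : ∀ x, slopeAt φ x ≤ S) : lipConst φ ≤ S := by
  refine le_of_forall_gt_imp_ge_of_dense fun T hT => ?_
  have hT0 : 0 ≤ T := hS.trans hT.le
  exact csInf_le ⟨0, fun _ hM => hM.1⟩ ⟨hT0, hX.abs_sub_le_of_eventually hφ hT0 fun x =>
    eventually_abs_sub_le_of_slopeAt_lt hL h ((hslope x).trans_lt hT)⟩

end Slopes

/-- In a nonempty length metric space, for a Lipschitz function `φ`:
`Lip(φ) = sup_x |Dφ|(x) = sup_x |D*φ|(x)`. -/
theorem stmt6 {X : Type*} [MetricSpace X] [Nonempty X] (hX : IsLengthSpace X)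
    (φ : X → ℝ) (hφ : ∃ L : ℝ≥0, LipschitzWith L φ) :
    (lipConst φ = ⨆ x : X, slopeAt φ x) ∧ (lipConst φ = ⨆ x : X, asympLipAt φ x) := by
  obtain ⟨L, hφL⟩ := hφ
  have hL : ∀ x y, |φ y - φ x| ≤ L * dist x y := fun x y => by
    rw [dist_comm, ← Real.dist_eq]
    exact hφL.dist_le_mul y x
  have hle (x : X) : slopeAt φ x ≤ asympLipAt φ x := slopeAt_le_asympLipAt L.2 hL x
  have hasymp (x : X) : asympLipAt φ x ≤ lipConst φ :=
    le_csInf ⟨L, L.2, hL⟩ fun _ hM => asympLipAt_le_s6 hM.1 hM.2 x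
  have hslope (x : X) : slopeAt φ x ≤ lipConst φ := (hle x).trans (hasymp x)
  have hb : BddAbove (Set.range (slopeAt φ)) := ⟨_, Set.forall_mem_range.2 hslope⟩
  have hb' : BddAbove (Set.range (asympLipAt φ)) := ⟨_, Set.forall_mem_range.2 hasymp⟩
  have h₁ : lipConst φ ≤ ⨆ x, slopeAt φ x :=
    hX.lipConst_le_of_slopeAt_le hφL.continuous L.2 hL
      (Real.iSup_nonneg (slopeAt_nonneg_s6 L.2 hL)) (le_ciSup hb)
  exact ⟨h₁.antisymm (ciSup_le hslope), (h₁.trans (ciSup_mono hb' hle)).antisymm (ciSup_le hasymp)⟩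
end

section
/- Let (X,d) be a metric space, let f : X → ℝ be Lipschitz with constant L, let s > 0 and x ∈ X, and let (y_n) be a minimizing sequence for Q_s f(x), i.e. f(y_n) + d²(x,y_n)/(2s) → Q_s f(x). Then limsup_{n→∞} d(x,y_n) ≤ 2sL. -/
open Filter Topology
open scoped ENNReal NNReal

/-- The Hopf–Lax semigroup `Q_t f(x) = inf_y ( f(y) + d²(x,y)/(2t) )` for `t > 0`,
with `Q_0 f = f`. -/
noncomputable def hopfLax {X : Type*} [MetricSpace X] (f : X → ℝ) (t : ℝ) (x : X) : ℝ :=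
  if t ≤ 0 then f x else ⨅ y : X, (f y + dist x y ^ 2 / (2 * t))

theorem LipschitzWith.sub_mul_dist_le {X : Type*} [PseudoMetricSpace X] {f : X → ℝ} {L : ℝ≥0}
    (hf : LipschitzWith L f) (x y : X) : f x - L * dist x y ≤ f y := by
  have h := (le_abs_self _).trans ((Real.dist_eq (f x) (f y)).symm.le.trans (hf.dist_le_mul x y))
  linarith

/-- For Lipschitz `f` and `t > 0` the infimum defining `Q_t f(x)` is over a set bounded below,
so it is at most its value at `y = x`. -/
theorem hopfLax_le_self {X : Type*} [MetricSpace X] {f : X → ℝ} {L : ℝ≥0}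
    (hf : LipschitzWith L f) {t : ℝ} (ht : 0 < t) (x : X) : hopfLax f t x ≤ f x := by
  have hbdd : BddBelow (Set.range fun y => f y + dist x y ^ 2 / (2 * t)) := by
    refine ⟨f x - t * L ^ 2 / 2, ?_⟩
    rintro _ ⟨y, rfl⟩
    have hlip := hf.sub_mul_dist_le x y
    have hsq : 0 ≤ (dist x y - t * L) ^ 2 / (2 * t) := by positivity
    have hexpand : (dist x y - t * L) ^ 2 / (2 * t)
        = dist x y ^ 2 / (2 * t) - L * dist x y + t * L ^ 2 / 2 := by
      field_simp
      ring
    dsimp only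
    linarith
  rw [hopfLax, if_neg ht.not_ge]
  simpa using ciInf_le hbdd x

/-- If `f` is `L`-Lipschitz, `s > 0` and `(yₙ)` is a minimizing sequence for
`Q_s f(x)`, then `limsupₙ d(x,yₙ) ≤ 2 s L`. -/
theorem stmt7 {X : Type*} [MetricSpace X] (f : X → ℝ) (L : ℝ≥0)
    (hf : LipschitzWith L f) (s : ℝ) (hs : 0 < s) (x : X) (y : ℕ → X)
    (hy : Tendsto (fun n => f (y n) + dist x (y n) ^ 2 / (2 * s)) atTop
      (𝓝 (hopfLax f s x))) :
    limsup (fun n => dist x (y n)) atTop ≤ 2 * s * L := by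
  refine le_of_forall_gt_imp_ge_of_dense fun c hc => ?_
  have hL : 0 ≤ 2 * s * L := by positivity
  have hgap : 0 < c * (c - 2 * s * L) / (2 * s) :=
    div_pos (mul_pos (hL.trans_lt hc) (sub_pos.2 hc)) (by positivity)
  refine limsup_le_of_le
    (isCoboundedUnder_le_of_le atTop (x := 0) fun n => dist_nonneg) ?_
  have hQ := hopfLax_le_self hf hs x
  have hlt : hopfLax f s x < f x + c * (c - 2 * s * L) / (2 * s) := by linarith
  filter_upwards [hy.eventually_lt_const hlt] with n hn
  by_contra! hcd
  have hlip := hf.sub_mul_dist_le x (y n)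
  have hmono : c * (c - 2 * s * L) / (2 * s)
      ≤ dist x (y n) * (dist x (y n) - 2 * s * L) / (2 * s) := by
    have : 0 ≤ c - 2 * s * L := (sub_pos.2 hc).le
    gcongr
  have hexpand : dist x (y n) * (dist x (y n) - 2 * s * L) / (2 * s)
      = dist x (y n) ^ 2 / (2 * s) - L * dist x (y n) := by
    field_simp
  linarith
end

section
/- Let (X,d) be a metric space, let f : X → ℝ be bounded and Lipschitz, let x ∈ X and t > 0. Then f(x) − Q_t f(x) = ∫₀ᵗ (D⁺(x,s))²/(2s²) ds = (t/2)·∫₀¹ ( D⁺(x,tr)/(tr) )² dr. -/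
open MeasureTheory Filter Topology
open scoped ENNReal NNReal

/-- `D⁺(x,s)`: the supremum, over all minimizing sequences `(yₙ)` for `Q_s f(x)`, of
`limsupₙ d(x,yₙ)`. -/
noncomputable def DPlus {X : Type*} [MetricSpace X] (f : X → ℝ) (x : X) (s : ℝ) : ℝ :=
  sSup {r : ℝ | ∃ y : ℕ → X,
    Tendsto (fun n => f (y n) + dist x (y n) ^ 2 / (2 * s)) atTop (𝓝 (hopfLax f s x)) ∧
    r = limsup (fun n => dist x (y n)) atTop}

/-- The sequences minimizing `f + d²(x,·)/(2s)`. -/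
def IsHopfLaxMinimizing {X : Type*} [MetricSpace X] (f : X → ℝ) (x : X) (s : ℝ)
    (y : ℕ → X) : Prop :=
  Tendsto (fun n => f (y n) + dist x (y n) ^ 2 / (2 * s)) atTop (𝓝 (hopfLax f s x))

section HopfLax

variable {X : Type*} [MetricSpace X] {f : X → ℝ} {M : ℝ} {L : ℝ≥0} {x : X} {s r t : ℝ}

theorem hopfLax_of_pos (hs : 0 < s) :
    hopfLax f s x = ⨅ y : X, (f y + dist x y ^ 2 / (2 * s)) :=
  if_neg (not_le.mpr hs)

theorem bddBelow_range_hopfLax (hbd : ∀ x, |f x| ≤ M) (hs : 0 < s) :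
    BddBelow (Set.range fun y : X => f y + dist x y ^ 2 / (2 * s)) := by
  refine ⟨-M, ?_⟩
  rintro _ ⟨y, rfl⟩
  have h₁ := (abs_le.mp (hbd y)).1
  have h₂ : 0 ≤ dist x y ^ 2 / (2 * s) := by positivity
  dsimp only
  linarith

theorem hopfLax_le (hbd : ∀ x, |f x| ≤ M) (hs : 0 < s) (y : X) :
    hopfLax f s x ≤ f y + dist x y ^ 2 / (2 * s) := by
  rw [hopfLax_of_pos hs]
  exact ciInf_le (bddBelow_range_hopfLax hbd hs) y

theorem hopfLax_le_self_s8 (hbd : ∀ x, |f x| ≤ M) (hs : 0 < s) : hopfLax f s x ≤ f x := by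
  simpa using hopfLax_le hbd hs (x := x) x

theorem sub_le_hopfLax (hf : LipschitzWith L f) (hs : 0 < s) :
    f x - (L : ℝ) ^ 2 * s / 2 ≤ hopfLax f s x := by
  rw [hopfLax_of_pos hs]
  have : Nonempty X := ⟨x⟩
  refine le_ciInf fun y => ?_
  have h₁ := (le_abs_self _).trans ((Real.dist_eq _ _).symm.trans_le (hf.dist_le_mul x y))
  have h₂ : dist x y ^ 2 / (2 * s) - L * dist x y + (L : ℝ) ^ 2 * s / 2
      = (dist x y - L * s) ^ 2 / (2 * s) := by
    field_simp
    ring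
  have h₃ : 0 ≤ (dist x y - L * s) ^ 2 / (2 * s) := by positivity
  linarith

theorem exists_isHopfLaxMinimizing (f : X → ℝ) (x : X) (hs : 0 < s)
    (hbd : ∀ x, |f x| ≤ M) : ∃ y, IsHopfLaxMinimizing f x s y := by
  have : Nonempty X := ⟨x⟩
  have h := exists_seq_tendsto_sInf (Set.range_nonempty _)
    (bddBelow_range_hopfLax (x := x) hbd hs)
  obtain ⟨u, -, hu, hmem⟩ := h
  choose y hy using hmem
  refine ⟨y, ?_⟩
  rw [IsHopfLaxMinimizing, hopfLax_of_pos hs]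
  exact hu.congr fun n => (hy n).symm

/-- Limsups of distances along a minimizing sequence are at most `2Ls`; we record the stronger
fact that distances are eventually below every larger number. -/
theorem IsHopfLaxMinimizing.eventually_dist_lt (hbd : ∀ x, |f x| ≤ M)
    (hf : LipschitzWith L f) (hs : 0 < s) {y : ℕ → X} (hy : IsHopfLaxMinimizing f x s y)
    {c : ℝ} (hc : 2 * L * s < c) : ∀ᶠ n in atTop, dist x (y n) < c := by
  have hc₀ : 0 < c := lt_of_le_of_lt (by positivity) hc
  have hlt : hopfLax f s x < f x + c * (c - 2 * L * s) / (2 * s) := by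
    have h₁ := hopfLax_le_self_s8 hbd hs (x := x)
    have h₂ : 0 < c * (c - 2 * L * s) / (2 * s) :=
      div_pos (mul_pos hc₀ (by linarith)) (by linarith)
    linarith
  filter_upwards [hy.eventually (gt_mem_nhds hlt)] with n hn
  by_contra! hle
  have h₁ := (le_abs_self _).trans
    ((Real.dist_eq _ _).symm.trans_le (hf.dist_le_mul x (y n)))
  have h₂ : c * (c - 2 * L * s) ≤ dist x (y n) * (dist x (y n) - 2 * L * s) :=
    mul_le_mul hle (by linarith) (by linarith) (by linarith)
  have h₃ := div_le_div_of_nonneg_right h₂ (by positivity : 0 ≤ 2 * s)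
  have h₄ : dist x (y n) * (dist x (y n) - 2 * L * s) / (2 * s)
      = dist x (y n) ^ 2 / (2 * s) - L * dist x (y n) := by
    field_simp
  linarith

theorem IsHopfLaxMinimizing.isBoundedUnder_dist (hbd : ∀ x, |f x| ≤ M)
    (hf : LipschitzWith L f) (hs : 0 < s) {y : ℕ → X} (hy : IsHopfLaxMinimizing f x s y) :
    IsBoundedUnder (· ≤ ·) atTop fun n => dist x (y n) :=
  ⟨_, eventually_map.mpr
    ((hy.eventually_dist_lt hbd hf hs (lt_add_one _)).mono fun _ h => h.le)⟩

theorem isCoboundedUnder_dist (x : X) (y : ℕ → X) :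
    IsCoboundedUnder (· ≤ ·) atTop fun n => dist x (y n) :=
  IsBoundedUnder.isCoboundedUnder_le ⟨0, eventually_map.mpr (.of_forall fun _ => dist_nonneg)⟩

theorem IsHopfLaxMinimizing.limsup_dist_le (hbd : ∀ x, |f x| ≤ M)
    (hf : LipschitzWith L f) (hs : 0 < s) {y : ℕ → X} (hy : IsHopfLaxMinimizing f x s y) :
    limsup (fun n => dist x (y n)) atTop ≤ 2 * L * s :=
  le_of_forall_gt_imp_ge_of_dense fun _ hc =>
    limsup_le_of_le (isCoboundedUnder_dist x y)
      ((hy.eventually_dist_lt hbd hf hs hc).mono fun _ h => h.le)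

theorem DPlus_le_of_forall (hbd : ∀ x, |f x| ≤ M) (hs : 0 < s) {c : ℝ}
    (h : ∀ y, IsHopfLaxMinimizing f x s y → limsup (fun n => dist x (y n)) atTop ≤ c) :
    DPlus f x s ≤ c := by
  obtain ⟨y, hy⟩ := exists_isHopfLaxMinimizing f x hs hbd
  refine csSup_le ⟨_, y, hy, rfl⟩ ?_
  rintro _ ⟨z, hz, rfl⟩
  exact h z hz

theorem DPlus_le (hbd : ∀ x, |f x| ≤ M) (hf : LipschitzWith L f) (hs : 0 < s) :
    DPlus f x s ≤ 2 * L * s :=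
  DPlus_le_of_forall hbd hs fun _ hy => hy.limsup_dist_le hbd hf hs

theorem IsHopfLaxMinimizing.limsup_dist_le_DPlus (hbd : ∀ x, |f x| ≤ M)
    (hf : LipschitzWith L f) (hs : 0 < s) {y : ℕ → X} (hy : IsHopfLaxMinimizing f x s y) :
    limsup (fun n => dist x (y n)) atTop ≤ DPlus f x s := by
  refine le_csSup ⟨2 * L * s, ?_⟩ ⟨y, hy, rfl⟩
  rintro _ ⟨z, hz, rfl⟩
  exact IsHopfLaxMinimizing.limsup_dist_le hbd hf hs hz

theorem DPlus_nonneg (hbd : ∀ x, |f x| ≤ M) (hf : LipschitzWith L f) (hs : 0 < s) :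
    0 ≤ DPlus f x s := by
  obtain ⟨y, hy⟩ := exists_isHopfLaxMinimizing f x hs hbd
  exact (le_limsup_of_frequently_le (Frequently.of_forall fun _ => dist_nonneg)
    (hy.isBoundedUnder_dist hbd hf hs)).trans (hy.limsup_dist_le_DPlus hbd hf hs)

theorem one_div_two_mul_sub_pos (hs : 0 < s) (hsr : s < r) :
    0 < 1 / (2 * s) - 1 / (2 * r) :=
  sub_pos.mpr (one_div_lt_one_div_of_lt (by positivity) (by linarith))

theorem DPlus_sq_mul_le_hopfLax_sub (hbd : ∀ x, |f x| ≤ M) (hf : LipschitzWith L f)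
    (hs : 0 < s) (hsr : s < r) :
    DPlus f x s ^ 2 * (1 / (2 * s) - 1 / (2 * r)) ≤ hopfLax f s x - hopfLax f r x := by
  have hw := one_div_two_mul_sub_pos hs hsr
  set w := 1 / (2 * s) - 1 / (2 * r) with hw_def
  have key : ∀ y, IsHopfLaxMinimizing f x s y → ∀ n, dist x (y n) ≤
      √((f (y n) + dist x (y n) ^ 2 / (2 * s) - hopfLax f r x) / w) := fun y _ n => by
    refine Real.le_sqrt_of_sq_le ((le_div_iff₀ hw).mpr ?_)
    have := hopfLax_le hbd (hs.trans hsr) (x := x) (y n)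
    have : dist x (y n) ^ 2 * w = dist x (y n) ^ 2 / (2 * s) - dist x (y n) ^ 2 / (2 * r) := by
      rw [hw_def]; ring
    linarith
  have hlim : ∀ y, IsHopfLaxMinimizing f x s y → Tendsto (fun n =>
      √((f (y n) + dist x (y n) ^ 2 / (2 * s) - hopfLax f r x) / w)) atTop
      (𝓝 (√((hopfLax f s x - hopfLax f r x) / w))) := fun y hy =>
    ((hy.sub_const _).div_const _).sqrt
  have hD : DPlus f x s ≤ √((hopfLax f s x - hopfLax f r x) / w) := by
    refine DPlus_le_of_forall hbd hs fun y hy => ?_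
    rw [← (hlim y hy).limsup_eq]
    exact limsup_le_limsup (.of_forall (key y hy)) (isCoboundedUnder_dist x y)
      (hlim y hy).isBoundedUnder_le
  have hnonneg : 0 ≤ (hopfLax f s x - hopfLax f r x) / w := by
    obtain ⟨y, hy⟩ := exists_isHopfLaxMinimizing f x hs hbd
    refine ge_of_tendsto' ((hy.sub_const (hopfLax f r x)).div_const w) fun n => ?_
    refine div_nonneg (sub_nonneg.mpr ((hopfLax_le hbd (hs.trans hsr) (y n)).trans ?_)) hw.le
    gcongr
  rw [← le_div_iff₀ hw, ← Real.sq_sqrt hnonneg]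
  exact pow_le_pow_left₀ (DPlus_nonneg hbd hf hs) hD 2

theorem hopfLax_sub_le_DPlus_sq_mul (hbd : ∀ x, |f x| ≤ M) (hf : LipschitzWith L f)
    (hs : 0 < s) (hsr : s < r) :
    hopfLax f s x - hopfLax f r x ≤ DPlus f x r ^ 2 * (1 / (2 * s) - 1 / (2 * r)) := by
  have hr := hs.trans hsr
  have hw := one_div_two_mul_sub_pos hs hsr
  set w := 1 / (2 * s) - 1 / (2 * r) with hw_def
  obtain ⟨z, hz⟩ := exists_isHopfLaxMinimizing f x hr hbd
  have key : ∀ n, √((hopfLax f s x - (f (z n) + dist x (z n) ^ 2 / (2 * r))) / w)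
      ≤ dist x (z n) := fun n => by
    refine Real.sqrt_le_iff.mpr ⟨dist_nonneg, (div_le_iff₀ hw).mpr ?_⟩
    have := hopfLax_le hbd hs (x := x) (z n)
    have : dist x (z n) ^ 2 * w = dist x (z n) ^ 2 / (2 * s) - dist x (z n) ^ 2 / (2 * r) := by
      rw [hw_def]; ring
    linarith
  have hlim : Tendsto (fun n =>
      √((hopfLax f s x - (f (z n) + dist x (z n) ^ 2 / (2 * r))) / w)) atTop
      (𝓝 (√((hopfLax f s x - hopfLax f r x) / w))) :=
    ((hz.const_sub _).div_const _).sqrt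
  have hD : √((hopfLax f s x - hopfLax f r x) / w) ≤ DPlus f x r := by
    refine le_trans ?_ (hz.limsup_dist_le_DPlus hbd hf hr)
    rw [← hlim.limsup_eq]
    exact limsup_le_limsup (.of_forall key) hlim.isCoboundedUnder_le
      (hz.isBoundedUnder_dist hbd hf hr)
  rw [← div_le_iff₀ hw]
  exact (Real.sqrt_le_iff.mp hD).2

theorem monotoneOn_DPlus (hbd : ∀ x, |f x| ≤ M) (hf : LipschitzWith L f) :
    MonotoneOn (DPlus f x) (Set.Ioi 0) := by
  intro s hs r hr hsr
  rcases hsr.eq_or_lt with rfl | hlt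
  · rfl
  have h := (DPlus_sq_mul_le_hopfLax_sub (x := x) hbd hf hs hlt).trans
    (hopfLax_sub_le_DPlus_sq_mul hbd hf hs hlt)
  exact (sq_le_sq₀ (DPlus_nonneg hbd hf hs) (DPlus_nonneg hbd hf hr)).mp
    (le_of_mul_le_mul_right h (one_div_two_mul_sub_pos hs hlt))

theorem hasDerivAt_hopfLax (hbd : ∀ x, |f x| ≤ M) (hf : LipschitzWith L f) (hs : 0 < s)
    (hc : ContinuousAt (DPlus f x) s) :
    HasDerivAt (fun r => hopfLax f r x) (-(DPlus f x s ^ 2 / (2 * s ^ 2))) s := by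
  have hp : HasDerivAt (fun r : ℝ => 1 / (2 * r)) (-(1 / (2 * s ^ 2))) s := by
    have h := (hasDerivAt_inv hs.ne').const_mul (1 / 2 : ℝ)
    have e : (fun r : ℝ => 1 / (2 * r)) = fun r => 1 / 2 * r⁻¹ := by
      ext r
      rw [one_div, mul_inv, one_div]
    rw [e]
    exact h.congr_deriv (by rw [one_div, one_div, mul_inv]; ring)
  have hφ : (fun r => DPlus f x r ^ 2 - DPlus f x s ^ 2) =o[𝓝 s] fun _ => (1 : ℝ) := by
    rw [Asymptotics.isLittleO_one_iff]
    exact tendsto_sub_nhds_zero_iff.mpr (hc.tendsto.pow 2)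
  have hprod : (fun r => (DPlus f x r ^ 2 - DPlus f x s ^ 2) * (1 / (2 * r) - 1 / (2 * s)))
      =o[𝓝 s] fun r => r - s := by
    simpa only [one_mul] using hφ.mul_isBigO hp.isBigO_sub
  have hrem : (fun r => hopfLax f r x - hopfLax f s x
      - DPlus f x s ^ 2 * (1 / (2 * r) - 1 / (2 * s))) =o[𝓝 s] fun r => r - s := by
    refine Asymptotics.IsBigO.trans_isLittleO (Asymptotics.IsBigO.of_bound 1 ?_) hprod
    filter_upwards [lt_mem_nhds hs] with r hr
    rw [one_mul, Real.norm_eq_abs, Real.norm_eq_abs]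
    rcases lt_trichotomy s r with hlt | rfl | hlt
    · have h₁ := DPlus_sq_mul_le_hopfLax_sub (x := x) hbd hf hs hlt
      have h₂ := hopfLax_sub_le_DPlus_sq_mul (x := x) hbd hf hs hlt
      exact abs_le_abs_of_nonpos (by linarith) (by linarith)
    · simp
    · have h₁ := DPlus_sq_mul_le_hopfLax_sub (x := x) hbd hf hr hlt
      have h₂ := hopfLax_sub_le_DPlus_sq_mul (x := x) hbd hf hr hlt
      rw [abs_of_nonpos (by linarith)]
      exact (by linarith : _ ≤ _).trans (neg_le_abs _)
  have hmain := hp.const_mul (DPlus f x s ^ 2)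
  rw [hasDerivAt_iff_isLittleO] at hmain ⊢
  refine (hrem.add hmain).congr_left fun r => ?_
  simp only [smul_eq_mul]
  ring

theorem continuousOn_hopfLax (hbd : ∀ x, |f x| ≤ M) (hf : LipschitzWith L f) :
    ContinuousOn (fun r => hopfLax f r x) (Set.Ici 0) := by
  intro s hs
  rcases (show (0 : ℝ) ≤ s from hs).eq_or_lt with rfl | hs₀
  · have h₀ : hopfLax f 0 x = f x := if_pos le_rfl
    have hlow : Tendsto (fun r : ℝ => f x - (L : ℝ) ^ 2 * r / 2) (𝓝[Set.Ici 0] 0)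
        (𝓝 (f x)) := by
      have : Continuous fun r : ℝ => f x - (L : ℝ) ^ 2 * r / 2 := by fun_prop
      simpa using (this.tendsto 0).mono_left nhdsWithin_le_nhds
    rw [ContinuousWithinAt, h₀]
    refine tendsto_of_tendsto_of_tendsto_of_le_of_le' hlow tendsto_const_nhds ?_ ?_ <;>
      filter_upwards [self_mem_nhdsWithin] with r hr <;>
      rcases (show (0 : ℝ) ≤ r from hr).eq_or_lt with rfl | hr₀
    · simp [h₀]
    · exact sub_le_hopfLax hf hr₀
    · exact h₀.le
    · exact hopfLax_le_self_s8 hbd hr₀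
  · refine ContinuousAt.continuousWithinAt ?_
    have hp : ContinuousAt (fun r : ℝ => 1 / (2 * r)) s :=
      continuousAt_const.div (by fun_prop) (by positivity)
    have hB : Tendsto (fun r : ℝ => (2 * L * (2 * s)) ^ 2 * |1 / (2 * r) - 1 / (2 * s)|) (𝓝 s)
        (𝓝 0) := by
      simpa using ((hp.tendsto.sub_const (1 / (2 * s))).abs).const_mul ((2 * L * (2 * s)) ^ 2)
    refine tendsto_iff_dist_tendsto_zero.mpr (squeeze_zero' (.of_forall fun _ => dist_nonneg)
      ?_ hB)
    have hstep : ∀ a b : ℝ, 0 < a → a < b → b < 2 * s → |hopfLax f a x - hopfLax f b x| ≤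
        (2 * L * (2 * s)) ^ 2 * |1 / (2 * a) - 1 / (2 * b)| := fun a b ha hab hb => by
      have hw := one_div_two_mul_sub_pos ha hab
      have hb₀ := ha.trans hab
      have h₁ := DPlus_sq_mul_le_hopfLax_sub (x := x) hbd hf ha hab
      have h₂ := hopfLax_sub_le_DPlus_sq_mul (x := x) hbd hf ha hab
      rw [abs_of_nonneg ((mul_nonneg (sq_nonneg _) hw.le).trans h₁), abs_of_pos hw]
      refine h₂.trans (mul_le_mul_of_nonneg_right ?_ hw.le)
      refine pow_le_pow_left₀ (DPlus_nonneg hbd hf hb₀) ((DPlus_le hbd hf hb₀).trans ?_) 2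
      gcongr
    filter_upwards [lt_mem_nhds hs₀, gt_mem_nhds (by linarith : s < 2 * s)] with r hr₀ hr
    rw [Real.dist_eq]
    rcases lt_trichotomy s r with hlt | rfl | hlt
    · rw [abs_sub_comm, abs_sub_comm (1 / (2 * r))]
      exact hstep s r hs₀ hlt hr
    · simp
    · exact hstep r s hr₀ hlt (by linarith)

theorem intervalIntegrable_DPlus (hbd : ∀ x, |f x| ≤ M) (hf : LipschitzWith L f)
    (ht : 0 < t) :
    IntervalIntegrable (fun s => DPlus f x s ^ 2 / (2 * s ^ 2)) volume 0 t := by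
  rw [intervalIntegrable_iff_integrableOn_Ioc_of_le ht.le]
  have hm : AEMeasurable (DPlus f x) (volume.restrict (Set.Ioc 0 t)) :=
    aemeasurable_restrict_of_monotoneOn measurableSet_Ioc
      ((monotoneOn_DPlus hbd hf).mono fun _ h => h.1)
  refine Integrable.of_bound ((hm.pow_const 2).div
    ((measurable_id.pow_const 2).const_mul 2).aemeasurable).aestronglyMeasurable
    (2 * (L : ℝ) ^ 2) ?_
  filter_upwards [ae_restrict_mem measurableSet_Ioc] with s hs
  have hs₀ : 0 < s := hs.1
  rw [Real.norm_of_nonneg (by positivity), div_le_iff₀ (by positivity)]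
  have := pow_le_pow_left₀ (DPlus_nonneg (x := x) hbd hf hs₀) (DPlus_le hbd hf hs₀) 2
  linarith

theorem countable_not_continuousAt_DPlus (hbd : ∀ x, |f x| ≤ M) (hf : LipschitzWith L f) :
    {s | 0 < s ∧ ¬ ContinuousAt (DPlus f x) s}.Countable := by
  refine (monotoneOn_DPlus (x := x) hbd hf).countable_not_continuousWithinAt.mono ?_
  rintro s ⟨hs, hns⟩
  exact ⟨hs, fun h => hns (h.continuousAt (Ioi_mem_nhds hs))⟩

theorem integral_DPlus_sq (hbd : ∀ x, |f x| ≤ M) (hf : LipschitzWith L f) (ht : 0 < t) :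
    ∫ s in (0:ℝ)..t, DPlus f x s ^ 2 / (2 * s ^ 2) = f x - hopfLax f t x := by
  have h := integral_eq_of_hasDerivAt_off_countable_of_le (fun r => hopfLax f r x)
    (fun s => -(DPlus f x s ^ 2 / (2 * s ^ 2))) ht.le
    (countable_not_continuousAt_DPlus (x := x) hbd hf)
    ((continuousOn_hopfLax hbd hf).mono fun _ h => h.1)
    (fun s hs => hasDerivAt_hopfLax hbd hf hs.1.1
      (not_not.mp fun hn => hs.2 ⟨hs.1.1, hn⟩))
    (intervalIntegrable_DPlus hbd hf ht).neg
  have h₀ : hopfLax f 0 x = f x := if_pos le_rfl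
  rw [intervalIntegral.integral_neg, h₀] at h
  linarith

end HopfLax

/-- For `f` bounded and Lipschitz, `x ∈ X` and `t > 0`:
`f(x) - Q_t f(x) = ∫₀ᵗ (D⁺(x,s))²/(2s²) ds = (t/2) ∫₀¹ (D⁺(x,tr)/(tr))² dr`. -/
theorem stmt8 {X : Type*} [MetricSpace X] (f : X → ℝ)
    (M : ℝ) (hbd : ∀ x, |f x| ≤ M) (L : ℝ≥0) (hf : LipschitzWith L f)
    (x : X) (t : ℝ) (ht : 0 < t) :
    f x - hopfLax f t x = ∫ s in (0:ℝ)..t, (DPlus f x s) ^ 2 / (2 * s ^ 2) ∧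
    f x - hopfLax f t x = (t / 2) * ∫ r in (0:ℝ)..1, (DPlus f x (t * r) / (t * r)) ^ 2 := by
  have h := integral_DPlus_sq (x := x) hbd hf ht
  refine ⟨h.symm, ?_⟩
  have hsub := intervalIntegral.mul_integral_comp_mul_left (a := 0) (b := 1)
    (f := fun s => (DPlus f x s / s) ^ 2) t
  rw [mul_zero, mul_one] at hsub
  rw [div_mul_eq_mul_div, hsub, ← h, ← intervalIntegral.integral_div]
  refine intervalIntegral.integral_congr fun s _ => ?_
  simp only [div_pow, div_div]
  rw [mul_comm]
end
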